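/- The group G(M) is generated by the elementary transformations: every g ∈ G(M) is a finite product of maps of the form φ(C), ψ(D), T(P,Q), and T(t), with C, D ∈ M₃(F) and P, Q ∈ GL₃(F). -/

import Mathlib

open Matrix

namespace Freudenthal

variable (F : Type*) [Field F]

/-- The cubic Jordan algebra `J = M₃(F)`. -/
abbrev Mat := Matrix (Fin 3) (Fin 3) F

/-- The trace bilinear form `(A, B) = tr(A·B)` on `J`. -/
def tb (A B : Mat F) : F := (A * B).trace

/-- The Freudenthal cross product `A × B = (A+B)# − A# − B#` (adjoint = adjugate). -/
def cross (A B : Mat F) : Mat F := (A + B).adjugate - A.adjugate - B.adjugate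

/-- The Freudenthal module `M = F ⊕ F ⊕ J ⊕ J`, elements `(α, β, A, B)`. -/
abbrev FM := F × F × Mat F × Mat F

/-- The quartic norm `q(x) = 8(A#,B#) − 8α·det A − 8β·det B − 2((A,B) − αβ)²`. -/
def qf (x : FM F) : F :=
  8 * tb F x.2.2.1.adjugate x.2.2.2.adjugate - 8 * x.1 * x.2.2.1.det
    - 8 * x.2.1 * x.2.2.2.det - 2 * (tb F x.2.2.1 x.2.2.2 - x.1 * x.2.1) ^ 2

/-- The symplectic form `{x, y} = αδ − βγ + (A,D) − (B,C)`. -/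
def symp (x y : FM F) : F :=
  x.1 * y.2.1 - x.2.1 * y.1 + tb F x.2.2.1 y.2.2.2 - tb F x.2.2.2 y.2.2.1

/-- Membership in the group `G(M)`: invertible `F`-linear transformations of `M`
preserving the quartic norm `q` and the symplectic form `{·,·}`. -/
def InG (g : FM F → FM F) : Prop :=
  IsLinearMap F g ∧ Function.Bijective g ∧
    (∀ x, qf F (g x) = qf F x) ∧ (∀ x y, symp F (g x) (g y) = symp F x y)

/-- The elementary transformation
`φ(C) : (α,β,A,B) ↦ (α + (B,C) + (A,C#) + β·det C, β, A + βC, B + A×C + βC#)`. -/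
def phiMap (C : Mat F) (x : FM F) : FM F :=
  (x.1 + tb F x.2.2.2 C + tb F x.2.2.1 C.adjugate + x.2.1 * C.det,
   x.2.1,
   x.2.2.1 + x.2.1 • C,
   x.2.2.2 + cross F x.2.2.1 C + x.2.1 • C.adjugate)

/-- The elementary transformation
`ψ(D) : (α,β,A,B) ↦ (α, β + (A,D) + (B,D#) + α·det D, A + B×D + αD#, B + αD)`. -/
def psiMap (D : Mat F) (x : FM F) : FM F :=
  (x.1,
   x.2.1 + tb F x.2.2.1 D + tb F x.2.2.2 D.adjugate + x.1 * D.det,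
   x.2.2.1 + cross F x.2.2.2 D + x.1 • D.adjugate,
   x.2.2.2 + x.1 • D)

/-- The elementary transformation
`T(P,Q) : (α,β,A,B) ↦ ((det Q/det P)·α, (det P/det Q)·β, P A Q⁻¹, Q B P⁻¹)`. -/
def Tmap (P Q : GL (Fin 3) F) (x : FM F) : FM F :=
  (((Q : Mat F).det / (P : Mat F).det) * x.1,
   ((P : Mat F).det / (Q : Mat F).det) * x.2.1,
   (P : Mat F) * x.2.2.1 * ((Q⁻¹ : GL (Fin 3) F) : Mat F),
   (Q : Mat F) * x.2.2.2 * ((P⁻¹ : GL (Fin 3) F) : Mat F))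

/-- The elementary transformation `T(t) : (α,β,A,B) ↦ (α, β, Aᵀ, Bᵀ)`. -/
def Ttr (x : FM F) : FM F := (x.1, x.2.1, x.2.2.1ᵀ, x.2.2.2ᵀ)

/-- Finite products of the elementary transformations
`φ(C)`, `ψ(D)`, `T(P,Q)`, `T(t)`. -/
inductive Word : (FM F → FM F) → Prop
  | phi (C : Mat F) : Word (phiMap F C)
  | psi (D : Mat F) : Word (psiMap F D)
  | tmap (P Q : GL (Fin 3) F) : Word (Tmap F P Q)
  | ttr : Word (Ttr F)
  | comp {g h : FM F → FM F} : Word g → Word h → Word (g ∘ h)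

end Freudenthal

open Freudenthal
namespace Freudenthal
variable {F : Type*} [Field F]

lemma tb_eq (A B : Mat F) : tb F A B = A 0 0 * B 0 0 + A 0 1 * B 1 0 + A 0 2 * B 2 0
   + (A 1 0 * B 0 1 + A 1 1 * B 1 1 + A 1 2 * B 2 1)
   + (A 2 0 * B 0 2 + A 2 1 * B 1 2 + A 2 2 * B 2 2) := by
  simp [tb, Matrix.trace_fin_three, Matrix.mul_apply, Fin.sum_univ_three]

/-- Extensionality for the module. -/
lemma FM_ext {x y : FM F} (h1 : x.1 = y.1) (h2 : x.2.1 = y.2.1) (h3 : x.2.2.1 = y.2.2.1)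
    (h4 : x.2.2.2 = y.2.2.2) : x = y := by
  ext1
  · exact h1
  ext1
  · exact h2
  ext1
  · exact h3
  · exact h4

lemma nondeg {N : Mat F} (h : ∀ Y : Mat F, tb F Y.adjugate N = 0) : N = 0 := by
  have h1 := h !![0,0,0;0,1,0;0,0,1]
  have h2 := h !![0,0,0;1,0,0;0,0,1]
  have h3 := h !![0,0,0;1,0,0;0,1,0]
  have h4 := h !![0,1,0;0,0,0;0,0,1]
  have h5 := h !![1,0,0;0,0,0;0,0,1]
  have h6 := h !![1,0,0;0,0,0;0,1,0]
  have h7 := h !![0,1,0;0,0,1;0,0,0]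
  have h8 := h !![1,0,0;0,0,1;0,0,0]
  have h9 := h !![1,0,0;0,1,0;0,0,0]
  simp [tb_eq, Matrix.adjugate_fin_three] at h1 h2 h3 h4 h5 h6 h7 h8 h9
  ext i j
  fin_cases i <;> fin_cases j <;> simp [*]

lemma nondeg' {N : Mat F} (h : ∀ Y : Mat F, tb F Y N = 0) : N = 0 :=
  nondeg fun Y => h _

lemma symp_phi (C : Mat F) (x y : FM F) : symp F (phiMap F C x) (phiMap F C y) = symp F x y := by
  obtain ⟨a, b, A, B⟩ := x
  obtain ⟨c, d, A', B'⟩ := y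
  simp [symp, phiMap, cross, tb_eq, Matrix.adjugate_fin_three, Matrix.det_fin_three]
  ring

lemma cross_eq (A B : Mat F) : cross F A B = A * B + B * A - A.trace • B - B.trace • A
    + (A.trace * B.trace - (A * B).trace) • (1 : Mat F) := by
  ext i j
  fin_cases i <;> fin_cases j <;>
    simp [cross, Matrix.adjugate_fin_three, Matrix.trace_fin_three, Matrix.mul_apply,
      Fin.sum_univ_three] <;> ring

lemma adj_add (A B : Mat F) : (A + B).adjugate = A.adjugate + B.adjugate + cross F A B := by
  simp [cross]

lemma cross_add_left (A A' B : Mat F) : cross F (A + A') B = cross F A B + cross F A' B := by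
  simp only [cross_eq, add_mul, mul_add, Matrix.trace_add, add_smul, smul_add]
  module

lemma cross_smul_left (t : F) (A B : Mat F) : cross F (t • A) B = t • cross F A B := by
  simp only [cross_eq, Matrix.trace_smul, smul_mul_assoc, mul_smul_comm, smul_eq_mul]
  module

lemma cross_comm (A B : Mat F) : cross F A B = cross F B A := by
  simp only [cross, add_comm A B]
  abel

lemma cross_add_right (A B B' : Mat F) : cross F A (B + B') = cross F A B + cross F A B' := by
  rw [cross_comm, cross_add_left, cross_comm B, cross_comm B']

lemma phi_add (C D : Mat F) (x : FM F) : phiMap F (C + D) x = phiMap F C (phiMap F D x) := by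
  obtain ⟨a, b, A, B⟩ := x
  apply FM_ext
  · simp [phiMap, cross, tb_eq, Matrix.adjugate_fin_three, Matrix.det_fin_three]
    ring
  · simp [phiMap]
  · simp only [phiMap]
    module
  · simp only [phiMap, adj_add, cross_add_left, cross_add_right, cross_smul_left, cross_comm D C]
    module

lemma q_phi_single (i j : Fin 3) (t : F) (x : FM F) :
    qf F (phiMap F (Matrix.single i j t) x) = qf F x := by
  obtain ⟨a, b, A, B⟩ := x
  fin_cases i <;> fin_cases j <;>
  · simp [qf, phiMap, cross, tb_eq, Matrix.adjugate_fin_three, Matrix.det_fin_three, Matrix.single]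
    ring

lemma q_phi (C : Mat F) : ∀ x : FM F, qf F (phiMap F C x) = qf F x := by
  induction C using Matrix.induction_on' with
  | h_zero => 
    intro x
    simp [phiMap, cross, tb_eq, Matrix.det_fin_three, Matrix.adjugate_fin_three]
  | h_add p q hp hq => 
    intro x
    rw [phi_add, hp, hq]
  | h_std_basis i j t => exact q_phi_single i j t

end Freudenthal

namespace Freudenthal
variable {F : Type*} [Field F]

lemma tb_add_left (A A' B : Mat F) : tb F (A + A') B = tb F A B + tb F A' B := by
  simp [tb, add_mul]

lemma tb_smul_left (t : F) (A B : Mat F) : tb F (t • A) B = t * tb F A B := by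
  simp [tb]

lemma tb_comm (A B : Mat F) : tb F A B = tb F B A := Matrix.trace_mul_comm A B

lemma tb_add_right (A B B' : Mat F) : tb F A (B + B') = tb F A B + tb F A B' := by
  simp [tb, mul_add]

lemma tb_smul_right (t : F) (A B : Mat F) : tb F A (t • B) = t * tb F A B := by
  simp [tb]

/-- The swap `(α, β, A, B) ↦ (β, α, B, A)`. -/
def sw (x : FM F) : FM F := (x.2.1, x.1, x.2.2.2, x.2.2.1)

lemma sw_sw (x : FM F) : sw (sw x) = x := rfl

lemma sw_add (x y : FM F) : sw (x + y) = sw x + sw y := rfl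

lemma sw_sub (x y : FM F) : sw (x - y) = sw x - sw y := rfl

lemma sw_smul (t : F) (x : FM F) : sw (t • x) = t • sw x := rfl

lemma psi_eq (D : Mat F) (x : FM F) : psiMap F D x = sw (phiMap F D (sw x)) := rfl

lemma q_sw (x : FM F) : qf F (sw x) = qf F x := by
  simp only [qf, sw]
  rw [tb_comm x.2.2.2.adjugate, tb_comm x.2.2.2]
  ring

lemma symp_sw (x y : FM F) : symp F (sw x) (sw y) = - symp F x y := by
  simp only [symp, sw]
  ring

lemma q_psi (D : Mat F) (x : FM F) : qf F (psiMap F D x) = qf F x := by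
  rw [psi_eq, q_sw, q_phi, q_sw]

lemma symp_psi (D : Mat F) (x y : FM F) :
    symp F (psiMap F D x) (psiMap F D y) = symp F x y := by
  rw [psi_eq, psi_eq, symp_sw, symp_phi, symp_sw, neg_neg]

lemma phi_lin (C : Mat F) : IsLinearMap F (phiMap F C) := by
  constructor
  · intro x y
    apply FM_ext
    · simp only [phiMap, Prod.fst_add, Prod.snd_add, tb_add_left]
      ring
    · simp only [phiMap, Prod.fst_add, Prod.snd_add]
    · simp only [phiMap, Prod.fst_add, Prod.snd_add]
      module
    · simp only [phiMap, Prod.fst_add, Prod.snd_add, cross_add_left]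
      module
  · intro t x
    apply FM_ext
    · simp only [phiMap, Prod.smul_fst, Prod.smul_snd, tb_smul_left, smul_eq_mul]
      ring
    · simp only [phiMap, Prod.smul_fst, Prod.smul_snd]
    · simp only [phiMap, Prod.smul_fst, Prod.smul_snd, smul_eq_mul]
      module
    · simp only [phiMap, Prod.smul_fst, Prod.smul_snd, cross_smul_left, smul_eq_mul]
      module

lemma psi_lin (C : Mat F) : IsLinearMap F (psiMap F C) := by
  constructor
  · intro x y
    simp only [psi_eq, sw_add, (phi_lin C).map_add]
  · intro t x
    simp only [psi_eq, sw_smul, (phi_lin C).map_smul]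

lemma T_lin (P Q : GL (Fin 3) F) : IsLinearMap F (Tmap F P Q) := by
  constructor
  · intro x y
    apply FM_ext <;> simp only [Tmap, Prod.fst_add, Prod.snd_add, mul_add, add_mul]
  · intro t x
    apply FM_ext <;> simp only [Tmap, Prod.smul_fst, Prod.smul_snd, smul_eq_mul,
      mul_smul_comm, smul_mul_assoc]
    · ring
    · ring

lemma tr_lin : IsLinearMap F (Ttr F) := by
  constructor
  · intro x y
    rfl
  · intro t x
    rfl

lemma tb_conj (P Q : GL (Fin 3) F) (A B : Mat F) :
    tb F ((P : Mat F) * A * ((Q⁻¹ : GL (Fin 3) F) : Mat F))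
      ((Q : Mat F) * B * ((P⁻¹ : GL (Fin 3) F) : Mat F)) = tb F A B := by
  have hQ : ((Q⁻¹ : GL (Fin 3) F) : Mat F) * (Q : Mat F) = 1 := Units.inv_mul Q
  have hP : ((P⁻¹ : GL (Fin 3) F) : Mat F) * (P : Mat F) = 1 := Units.inv_mul P
  unfold tb
  calc _ = ((P : Mat F) * (A * (((Q⁻¹ : GL (Fin 3) F) : Mat F) * (Q : Mat F)) * B
            * ((P⁻¹ : GL (Fin 3) F) : Mat F))).trace := by simp only [mul_assoc]
    _ = ((A * (((Q⁻¹ : GL (Fin 3) F) : Mat F) * (Q : Mat F)) * B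
            * (((P⁻¹ : GL (Fin 3) F) : Mat F) * (P : Mat F)))).trace := by
          rw [Matrix.trace_mul_comm]; simp only [mul_assoc]
    _ = _ := by rw [hQ, hP]; simp

lemma tb_conj' (P P' Q Q' A B : Mat F) (hP : P * P' = 1) (hQ : Q' * Q = 1) :
    tb F (Q * A * P) (P' * B * Q') = tb F A B := by
  unfold tb
  calc _ = (Q * (A * (P * P') * B * Q')).trace := by simp only [mul_assoc]
    _ = (A * (P * P') * B * (Q' * Q)).trace := by
          rw [Matrix.trace_mul_comm]; simp only [mul_assoc]
    _ = _ := by rw [hP, hQ]; simp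

lemma GL_det_ne (P : GL (Fin 3) F) : (P : Mat F).det ≠ 0 :=
  ((Matrix.isUnit_iff_isUnit_det _).1 P.isUnit).ne_zero

lemma GL_det_inv (P : GL (Fin 3) F) :
    ((P⁻¹ : GL (Fin 3) F) : Mat F).det = ((P : Mat F).det)⁻¹ := by
  have hP : ((P⁻¹ : GL (Fin 3) F) : Mat F) * (P : Mat F) = 1 := Units.inv_mul P
  have := congrArg Matrix.det hP
  rw [Matrix.det_mul, Matrix.det_one] at this
  exact eq_inv_of_mul_eq_one_left this

lemma q_T (P Q : GL (Fin 3) F) (x : FM F) : qf F (Tmap F P Q x) = qf F x := by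
  have hp := GL_det_ne P
  have hq := GL_det_ne Q
  have hQ : ((Q⁻¹ : GL (Fin 3) F) : Mat F) * (Q : Mat F) = 1 := Units.inv_mul Q
  have hQ' : (Q : Mat F) * ((Q⁻¹ : GL (Fin 3) F) : Mat F) = 1 := Units.mul_inv Q
  have hP : ((P⁻¹ : GL (Fin 3) F) : Mat F) * (P : Mat F) = 1 := Units.inv_mul P
  have key : tb F ((P : Mat F) * x.2.2.1 * ((Q⁻¹ : GL (Fin 3) F) : Mat F)).adjugate
      ((Q : Mat F) * x.2.2.2 * ((P⁻¹ : GL (Fin 3) F) : Mat F)).adjugate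
      = tb F x.2.2.1.adjugate x.2.2.2.adjugate := by
    simp only [Matrix.adjugate_mul_distrib]
    rw [← mul_assoc, ← mul_assoc]
    apply tb_conj'
    · rw [← Matrix.adjugate_mul_distrib, hP, Matrix.adjugate_one]
    · rw [← Matrix.adjugate_mul_distrib, hQ, Matrix.adjugate_one]
  simp only [qf, Tmap]
  rw [key, tb_conj]
  simp only [Matrix.det_mul, GL_det_inv]
  field_simp

lemma symp_T (P Q : GL (Fin 3) F) (x y : FM F) :
    symp F (Tmap F P Q x) (Tmap F P Q y) = symp F x y := by
  have hp := GL_det_ne P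
  have hq := GL_det_ne Q
  simp only [symp, Tmap]
  rw [tb_conj, tb_conj]
  field_simp

lemma tb_tr (A B : Mat F) : tb F Aᵀ Bᵀ = tb F A B := by
  rw [tb, ← Matrix.transpose_mul, Matrix.trace_transpose, tb_comm, tb]

lemma q_tr (x : FM F) : qf F (Ttr F x) = qf F x := by
  simp only [qf, Ttr, ← Matrix.adjugate_transpose, tb_tr, Matrix.det_transpose]

lemma symp_tr (x y : FM F) : symp F (Ttr F x) (Ttr F y) = symp F x y := by
  simp only [symp, Ttr, tb_tr]

lemma phi_zero (x : FM F) : phiMap F 0 x = x := by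
  have h : (0 : Mat F).adjugate = 0 := by
    ext i j
    fin_cases i <;> fin_cases j <;> simp [Matrix.adjugate_fin_three]
  apply FM_ext <;> simp [phiMap, cross, h, tb]

lemma phi_neg (C : Mat F) (x : FM F) : phiMap F (-C) (phiMap F C x) = x := by
  rw [← phi_add, neg_add_cancel, phi_zero]

lemma psi_neg (C : Mat F) (x : FM F) : psiMap F (-C) (psiMap F C x) = x := by
  rw [psi_eq, psi_eq, sw_sw, phi_neg, sw_sw]

lemma T_inv (P Q : GL (Fin 3) F) (x : FM F) : Tmap F P⁻¹ Q⁻¹ (Tmap F P Q x) = x := by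
  have hp := GL_det_ne P
  have hq := GL_det_ne Q
  have hQ : ((Q⁻¹ : GL (Fin 3) F) : Mat F) * (Q : Mat F) = 1 := Units.inv_mul Q
  have hP : ((P⁻¹ : GL (Fin 3) F) : Mat F) * (P : Mat F) = 1 := Units.inv_mul P
  apply FM_ext
  · simp only [Tmap, GL_det_inv]
    field_simp
  · simp only [Tmap, GL_det_inv]
    field_simp
  · simp only [Tmap, inv_inv]
    rw [← mul_assoc, ← mul_assoc, hP, one_mul, mul_assoc, hQ, mul_one]
  · simp only [Tmap, inv_inv]
    rw [← mul_assoc, ← mul_assoc, hQ, one_mul, mul_assoc, hP, mul_one]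

lemma Word.inv {w : FM F → FM F} (hw : Word F w) :
    ∃ w', Word F w' ∧ (∀ x, w' (w x) = x) ∧ (∀ x, w (w' x) = x) := by
  induction hw with
  | phi C => exact ⟨_, .phi (-C), phi_neg C, fun x => by simpa using phi_neg (-C) x⟩
  | psi C => exact ⟨_, .psi (-C), psi_neg C, fun x => by simpa using psi_neg (-C) x⟩
  | tmap P Q => exact ⟨_, .tmap P⁻¹ Q⁻¹, T_inv P Q, fun x => by simpa using T_inv P⁻¹ Q⁻¹ x⟩
  | ttr => exact ⟨_, .ttr, fun x => rfl, fun x => rfl⟩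
  | comp _ _ h1 h2 =>
    obtain ⟨w1, a1, b1, c1⟩ := h1
    obtain ⟨w2, a2, b2, c2⟩ := h2
    exact ⟨_, .comp a2 a1, fun x => by simp [b1, b2], fun x => by simp [c1, c2]⟩

lemma InG.comp {g h : FM F → FM F} (hg : InG F g) (hh : InG F h) : InG F (g ∘ h) := by
  obtain ⟨a1, b1, c1, d1⟩ := hg
  obtain ⟨a2, b2, c2, d2⟩ := hh
  refine ⟨⟨fun x y => ?_, fun t x => ?_⟩, b1.comp b2, fun x => ?_, fun x y => ?_⟩
  · simp [a1.map_add, a2.map_add]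
  · simp [a1.map_smul, a2.map_smul]
  · simp [c1, c2]
  · simp [d1, d2]

lemma Word.inG {w : FM F → FM F} (hw : Word F w) : InG F w := by
  have bij : ∀ {w : FM F → FM F}, Word F w → Function.Bijective w := by
    intro w hw
    obtain ⟨w', _, h1, h2⟩ := hw.inv
    exact ⟨Function.LeftInverse.injective h1, Function.RightInverse.surjective h2⟩
  induction hw with
  | phi C => exact ⟨phi_lin C, bij (.phi C), q_phi C, symp_phi C⟩
  | psi C => exact ⟨psi_lin C, bij (.psi C), q_psi C, symp_psi C⟩
  | tmap P Q => exact ⟨T_lin P Q, bij (.tmap P Q), q_T P Q, symp_T P Q⟩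
  | ttr => exact ⟨tr_lin, bij .ttr, q_tr, symp_tr⟩
  | comp _ _ h1 h2 => exact h1.comp h2

lemma Word.cancel {w g : FM F → FM F} (hw : Word F w) (h : Word F (w ∘ g)) : Word F g := by
  obtain ⟨w', a, b, _⟩ := hw.inv
  have : w' ∘ (w ∘ g) = g := by
    funext x
    simp [b]
  rw [← this]
  exact .comp a h

/-- The characteristic property of rank one elements. -/
def RkOne (x : FM F) : Prop :=
  ∀ y, qf F (y + x) + qf F (y - x) - 2 * qf F y = -4 * symp F x y ^ 2

lemma RkOne.map {g : FM F → FM F} (hg : InG F g) {x : FM F} (hx : RkOne x) : RkOne (g x) := by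
  obtain ⟨a, b, c, d⟩ := hg
  intro y
  obtain ⟨y, rfl⟩ := b.2 y
  rw [← a.map_add, ← a.map_sub, c, c, c, d]
  exact hx y

lemma RkOne.sw {x : FM F} (hx : RkOne x) : RkOne (sw x) := by
  intro y
  rw [← sw_sw y, ← sw_add, ← sw_sub, q_sw, q_sw, q_sw, symp_sw, hx]
  ring

/-- The base point. -/
def e0 : FM F := (1, 0, 0, 0)

lemma rk_e0 : RkOne (e0 : FM F) := by
  rintro ⟨a, b, A, B⟩
  simp [qf, e0, symp, tb]
  ring

lemma rk_red (h2 : (2 : F) ≠ 0) {a b : F} {A : Mat F} (ha : a ≠ 0)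
    (h : RkOne ((a, b, A, 0) : FM F)) : b = 0 ∧ A = 0 := by
  have z : (0 : Mat F).adjugate = 0 := by
    ext i j
    fin_cases i <;> fin_cases j <;> simp [Matrix.adjugate_fin_three]
  have neg_adj : ∀ X : Mat F, (-X).adjugate = X.adjugate := by
    intro X
    ext i j
    fin_cases i <;> fin_cases j <;> simp [Matrix.adjugate_fin_three]
  have neg_det : ∀ X : Mat F, (-X).det = -X.det := by
    intro X
    simp [Matrix.det_fin_three]
    ring
  have h16 : (16 : F) ≠ 0 := by
    have : (16 : F) = 2 ^ 4 := by norm_num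
    rw [this]
    exact pow_ne_zero _ h2
  have h4 : (4 : F) ≠ 0 := by
    have : (4 : F) = 2 ^ 2 := by norm_num
    rw [this]
    exact pow_ne_zero _ h2
  have k0 := h 0
  simp [qf, symp, tb, z, neg_det, neg_adj] at k0
  have k1 : ∀ D : Mat F, tb F D.adjugate A.adjugate = 0 := by
    intro D
    have := h (0, 0, 0, D)
    simp [qf, symp, z, neg_adj, neg_det] at this
    have e1 : tb F (-A) D = - tb F A D := by simp [tb]
    have e2 : tb F (0 : Mat F) D = 0 := by simp [tb]
    have e3 : tb F (0 : Mat F) D.adjugate = 0 := by simp [tb]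
    have e4 : tb F (0 : Mat F) (0 : Mat F) = 0 := by simp [tb]
    simp only [e1, e2, e3, e4] at this
    apply (mul_eq_zero.1 _).resolve_left h16
    rw [tb_comm]
    linear_combination this - k0
  have hA : A.adjugate = 0 := nondeg k1
  have hd : A.det = 0 := by
    have := Matrix.mul_adjugate A
    rw [hA, mul_zero] at this
    have := congrFun (congrFun this 0) 0
    simpa using this.symm
  have hb : b = 0 := by
    rw [hd] at k0
    have : 4 * (a * b) ^ 2 = 0 := by linear_combination -k0
    have := pow_eq_zero_iff (two_ne_zero) |>.1 ((mul_eq_zero.1 this).resolve_left h4)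
    exact (mul_eq_zero.1 this).resolve_left ha
  refine ⟨hb, nondeg fun C => ?_⟩
  subst hb
  have := h (0, 0, C, 0)
  simp [qf, symp, z, neg_adj, neg_det, tb] at this
  have e : (C + A).det - (C - A).det = 2 * tb F C.adjugate A + 2 * A.det := by
    simp [tb_eq, Matrix.det_fin_three, Matrix.adjugate_fin_three]
    ring
  rw [hd] at e
  apply (mul_eq_zero.1 _).resolve_left h16
  apply (mul_eq_zero.1 _).resolve_left ha
  linear_combination -this - 8 * a * e

end Freudenthal

namespace Freudenthal
variable {F : Type*} [Field F]

lemma exists_phi_ne (h2 : (2 : F) ≠ 0) (h3 : (3 : F) ≠ 0) {x : FM F} (hx : x ≠ 0) :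
    ∃ C, (phiMap F C x).1 ≠ 0 := by
  by_contra hcon
  push Not at hcon
  apply hx
  obtain ⟨a, b, A, B⟩ := x
  have h0 : a = 0 := by
    have := hcon 0
    rwa [phi_zero] at this
  subst h0
  have neg_adj : ∀ X : Mat F, (-X).adjugate = X.adjugate := by
    intro X
    ext i j
    fin_cases i <;> fin_cases j <;> simp [Matrix.adjugate_fin_three]
  have neg_det : ∀ X : Mat F, (-X).det = -X.det := by
    intro X
    simp [Matrix.det_fin_three]
    ring
  have tb_neg : ∀ X Y : Mat F, tb F X (-Y) = - tb F X Y := by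
    intro X Y
    simp [tb]
  have hA : A = 0 := nondeg fun C => by
    have k1 := hcon C
    have k2 := hcon (-C)
    simp only [phiMap, neg_adj, neg_det, tb_neg] at k1 k2
    apply (mul_eq_zero.1 _).resolve_left h2
    rw [tb_comm]
    linear_combination k1 + k2
  subst hA
  have z : ∀ X : Mat F, tb F 0 X = 0 := by
    intro X
    simp [tb]
  have hb : b = 0 := by
    have k1 := hcon 1
    have k2 := hcon ((2 : F) • (1 : Mat F))
    simp only [phiMap, z, tb_smul_right, Matrix.det_smul, Matrix.det_one, Fintype.card_fin] at k1 k2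
    apply (mul_eq_zero.1 _).resolve_left h2
    apply (mul_eq_zero.1 _).resolve_left h3
    linear_combination k2 - 2 * k1
  subst hb
  have hB : B = 0 := nondeg' fun C => by
    have k1 := hcon C
    simp only [phiMap, z] at k1
    rw [tb_comm]
    linear_combination k1
  subst hB
  rfl

lemma exists_GL_det {a : F} (ha : a ≠ 0) : ∃ P : GL (Fin 3) F, (P : Mat F).det = a :=
  ⟨Matrix.GeneralLinearGroup.mkOfDetNeZero !![a,0,0;0,1,0;0,0,1]
    (by simpa [Matrix.det_fin_three] using ha), by
      simp [Matrix.GeneralLinearGroup.mkOfDetNeZero, Matrix.det_fin_three]⟩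

lemma transitive (h2 : (2 : F) ≠ 0) (h3 : (3 : F) ≠ 0) {x : FM F} (hx : x ≠ 0)
    (hr : RkOne x) : ∃ w, Word F w ∧ w x = e0 := by
  obtain ⟨C, hC⟩ := exists_phi_ne h2 h3 hx
  set y := phiMap F C x with hy
  have ry : RkOne y := hr.map (Word.phi C).inG
  set z := psiMap F (-(y.1⁻¹ • y.2.2.2)) y with hz
  have rz : RkOne z := ry.map (Word.psi _).inG
  have z1 : z.1 = y.1 := rfl
  have z4 : z.2.2.2 = 0 := by
    simp [hz, psiMap, smul_smul, hC]
  have rz' : RkOne ((y.1, z.2.1, z.2.2.1, 0) : FM F) := by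
    rw [← z1, ← z4]
    exact rz
  obtain ⟨k2, k3⟩ := rk_red h2 hC rz'
  obtain ⟨P, hP⟩ := exists_GL_det hC
  refine ⟨_, .comp (.tmap P 1) (.comp (.psi (-(y.1⁻¹ • y.2.2.2))) (.phi C)), ?_⟩
  change Tmap F P 1 z = e0
  apply FM_ext
  · simp [Tmap, e0, hP, z1, hC]
  · simp [Tmap, e0, k2]
  · simp [Tmap, e0, k3]
  · simp [Tmap, e0, z4]

/-- Reduction to maps fixing both base points. -/
lemma reduce (h2 : (2 : F) ≠ 0) (h3 : (3 : F) ≠ 0)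
    (H : ∀ g : FM F → FM F, InG F g → g e0 = e0 → g (sw e0) = sw e0 → Word F g)
    (g : FM F → FM F) (hg : InG F g) : Word F g := by
  have e_ne : (e0 : FM F) ≠ 0 := by
    intro h
    have := congrArg Prod.fst h
    simp [e0] at this
  have ge_ne : g e0 ≠ 0 := by
    intro h
    apply e_ne
    apply hg.2.1.1
    rw [h, hg.1.map_zero]
  obtain ⟨w, hw, hwe⟩ := transitive h2 h3 ge_ne (rk_e0.map hg)
  apply hw.cancel
  have hg1 := hw.inG.comp hg
  have hg1e : (w ∘ g) e0 = e0 := hwe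
  generalize w ∘ g = k at hg1 hg1e
  set y := k (sw e0) with hy
  have yb : y.2.1 = 1 := by
    have := hg1.2.2.2 e0 (sw e0)
    rw [hg1e, ← hy] at this
    simpa [symp, e0, sw, tb] using this
  have hwp : Word F (phiMap F (-y.2.2.1)) := .phi _
  apply hwp.cancel
  have hfe : phiMap F (-y.2.2.1) e0 = e0 := by
    apply FM_ext <;> simp [phiMap, e0, cross, tb]
  set z := phiMap F (-y.2.2.1) y with hz
  have rz : RkOne (sw z) := ((rk_e0.sw.map hg1).map hwp.inG).sw
  have z2 : z.2.1 = 1 := yb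
  have z3 : z.2.2.1 = 0 := by simp [hz, phiMap, yb]
  have rz' : RkOne ((1, z.1, z.2.2.2, 0) : FM F) := by
    rw [← z2, ← z3]
    exact rz
  obtain ⟨k1, k4⟩ := rk_red h2 one_ne_zero rz'
  apply H _ (hwp.inG.comp hg1)
  · simp [hg1e, hfe]
  · change z = sw e0
    exact FM_ext k1 z2 z3 k4

lemma det_polar (Y N : Mat F) : (Y + N).det - (Y - N).det = 2 * tb F Y.adjugate N + 2 * N.det := by
  simp [tb_eq, Matrix.det_fin_three, Matrix.adjugate_fin_three]
  ring

/-- Maps fixing the base points come from determinant preservers. -/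
lemma levi (h2 : (2 : F) ≠ 0) (g : FM F → FM F) (hg : InG F g) (he : g e0 = e0)
    (hf : g (sw e0) = sw e0) : ∃ h k : Mat F →ₗ[F] Mat F, Function.Surjective h ∧
      (∀ A, (h A).det = A.det) ∧ (∀ A B, tb F (h A) (k B) = tb F A B) ∧
      ∀ a b A B, g (a, b, A, B) = (a, b, h A, k B) := by
  obtain ⟨gl, gb, gq, gs⟩ := hg
  have h8 : (8 : F) ≠ 0 := by
    have : (8 : F) = 2 ^ 3 := by norm_num
    rw [this]
    exact pow_ne_zero _ h2
  let G : FM F →ₗ[F] FM F := gl.mk' g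
  have Gg : ∀ x, G x = g x := fun x => rfl
  let H1 : (Mat F × Mat F) →ₗ[F] Mat F := LinearMap.fst F _ _ ∘ₗ LinearMap.snd F _ _ ∘ₗ
    LinearMap.snd F _ _ ∘ₗ G ∘ₗ LinearMap.inr F F _ ∘ₗ LinearMap.inr F F _
  let H2 : (Mat F × Mat F) →ₗ[F] Mat F := LinearMap.snd F _ _ ∘ₗ LinearMap.snd F _ _ ∘ₗ
    LinearMap.snd F _ _ ∘ₗ G ∘ₗ LinearMap.inr F F _ ∘ₗ LinearMap.inr F F _
  have form0 : ∀ A B, g (0, 0, A, B) = (0, 0, H1 (A, B), H2 (A, B)) := by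
    intro A B
    have s1 := gs e0 (0, 0, A, B)
    have s2 := gs (sw e0) (0, 0, A, B)
    rw [he] at s1
    rw [hf] at s2
    apply FM_ext
    · simpa [symp, e0, sw, tb] using s2
    · simpa [symp, e0, sw, tb] using s1
    · rfl
    · rfl
  have form : ∀ a b A B, g (a, b, A, B) = (a, b, H1 (A, B), H2 (A, B)) := by
    intro a b A B
    have : ((a, b, A, B) : FM F) = a • e0 + b • sw e0 + (0, 0, A, B) := by
      apply FM_ext <;> simp [e0, sw]
    rw [this, gl.map_add, gl.map_add, gl.map_smul, gl.map_smul, he, hf, form0]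
    apply FM_ext <;> simp [e0, sw]
  have d1 : ∀ A B, (H1 (A, B)).det = A.det := by
    intro A B
    have k0 := gq (0, 0, A, B)
    have k1 := gq (1, 0, A, B)
    rw [form] at k0 k1
    simp only [qf] at k0 k1
    apply mul_left_cancel₀ h8
    linear_combination k0 - k1
  have d2 : ∀ A B, (H2 (A, B)).det = B.det := by
    intro A B
    have k0 := gq (0, 0, A, B)
    have k1 := gq (0, 1, A, B)
    rw [form] at k0 k1
    simp only [qf] at k0 k1
    apply mul_left_cancel₀ h8
    linear_combination k0 - k1
  have sur : ∀ X Y, ∃ A B, H1 (A, B) = X ∧ H2 (A, B) = Y := by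
    intro X Y
    obtain ⟨⟨a, b, A, B⟩, h⟩ := gb.2 (0, 0, X, Y)
    rw [form] at h
    simp only [Prod.mk.injEq] at h
    exact ⟨A, B, h.2.2⟩
  have n1 : ∀ B, H1 (0, B) = 0 := by
    intro B
    apply nondeg
    intro Y
    obtain ⟨A, B', h, _⟩ := sur Y 0
    have := det_polar Y (H1 (0, B))
    rw [← h, ← map_add, ← map_sub, Prod.mk_add_mk, Prod.mk_sub_mk, d1, d1, d1, h] at this
    simp at this
    exact this.resolve_left h2
  have n2 : ∀ A, H2 (A, 0) = 0 := by
    intro B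
    apply nondeg
    intro Y
    obtain ⟨A, B', _, h⟩ := sur 0 Y
    have := det_polar Y (H2 (B, 0))
    rw [← h, ← map_add, ← map_sub, Prod.mk_add_mk, Prod.mk_sub_mk, d2, d2, d2, h] at this
    simp at this
    exact this.resolve_left h2
  have e1 : ∀ A B, H1 (A, B) = H1 (A, 0) := by
    intro A B
    have : ((A, B) : Mat F × Mat F) = (A, 0) + (0, B) := by simp
    rw [this, map_add, n1, add_zero]
  have e2 : ∀ A B, H2 (A, B) = H2 (0, B) := by
    intro A B
    have : ((A, B) : Mat F × Mat F) = (A, 0) + (0, B) := by simp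
    rw [this, map_add, n2, zero_add]
  refine ⟨H1 ∘ₗ LinearMap.inl F _ _, H2 ∘ₗ LinearMap.inr F _ _, ?_, ?_, ?_, ?_⟩
  · intro X
    obtain ⟨A, B, h, _⟩ := sur X 0
    exact ⟨A, by rw [← h, e1]; rfl⟩
  · intro A
    exact d1 A 0
  · intro A B
    have := gs (0, 0, A, 0) (0, 0, 0, B)
    rw [form, form, n2, n1] at this
    simpa [symp, tb] using this
  · intro a b A B
    rw [form, e1, e2]
    rfl

end Freudenthal

namespace Freudenthal
variable {F : Type*} [Field F]

lemma adj_formula (h2 : (2 : F) ≠ 0) (X : Mat F) : X.adjugate = X * X - X.trace • X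
    + X.adjugate.trace • (1 : Mat F) := by
  ext i j
  fin_cases i <;> fin_cases j <;>
    simp [Matrix.adjugate_fin_three, Matrix.trace_fin_three, Matrix.mul_apply,
      Fin.sum_univ_three] <;> ring

/-- A unital determinant preserver is a Jordan homomorphism. -/
lemma jordan (h2 : (2 : F) ≠ 0) (h : Mat F →ₗ[F] Mat F) (hs : Function.Surjective h)
    (hd : ∀ A, (h A).det = A.det) (h1 : h 1 = 1) (X Y : Mat F) :
    h (X * Y + Y * X) = h X * h Y + h Y * h X := by
  have pol : ∀ Y X, tb F (h Y).adjugate (h X) = tb F Y.adjugate X := by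
    intro Y X
    have k1 := det_polar Y X
    have k2 := det_polar (h Y) (h X)
    rw [← map_add, ← map_sub, hd, hd, hd] at k2
    apply mul_left_cancel₀ h2
    linear_combination k1 - k2
  have tr : ∀ X, (h X).trace = X.trace := by
    intro X
    simpa [h1, tb] using pol 1 X
  have tra : ∀ X, (h X).adjugate.trace = X.adjugate.trace := by
    intro X
    simpa [h1, tb] using pol X 1
  have trf : ∀ X Y, tb F (h X) (h Y) = tb F X Y := by
    intro X Y
    have id : ∀ X Y : Mat F, tb F X Y = X.trace * Y.trace
        - ((X + Y).adjugate.trace - X.adjugate.trace - Y.adjugate.trace) := by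
      intro X Y
      simp [tb_eq, Matrix.trace_fin_three, Matrix.adjugate_fin_three]
      ring
    rw [id, id, ← map_add, tr, tr, tra, tra, tra]
  have ha : ∀ X, (h X).adjugate = h X.adjugate := by
    intro X
    rw [← sub_eq_zero]
    apply nondeg'
    intro Z
    obtain ⟨Y, rfl⟩ := hs Z
    have : tb F (h Y) ((h X).adjugate - h X.adjugate)
        = tb F (h Y) (h X).adjugate - tb F (h Y) (h X.adjugate) := by
      simp [tb, mul_sub]
    rw [this, trf, tb_comm, pol, tb_comm, sub_self]
  have sq : ∀ X, h (X * X) = h X * h X := by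
    intro X
    have k1 := ha X
    rw [adj_formula h2 (h X)] at k1
    conv_rhs at k1 => rw [adj_formula h2 X]
    rw [map_add, map_sub, map_smul, map_smul, h1, tr, tra] at k1
    simpa using k1.symm
  have k := sq (X + Y)
  simp only [add_mul, mul_add, map_add, sq] at k
  rw [map_add]
  have kk : h X * h X + (h (X * Y) + h (Y * X)) + h Y * h Y
      = h X * h X + (h X * h Y + h Y * h X) + h Y * h Y := by
    refine Eq.trans ?_ (k.trans ?_) <;> abel
  exact add_left_cancel (add_right_cancel kk)

/-- Simultaneous diagonalisation of three orthogonal idempotents. -/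
lemma diag_idem (p : Fin 3 → Mat F) (hp : ∀ i, p i ≠ 0) (hi : ∀ i, p i * p i = p i)
    (ho : ∀ i j, i ≠ j → p i * p j = 0) :
    ∃ U : Mat F, U.det ≠ 0 ∧ ∀ i, p i * U = U * Matrix.single i i 1 := by
  have ex : ∀ i, ∃ u : Fin 3 → F, u ≠ 0 ∧ p i *ᵥ u = u := by
    intro i
    by_contra hcon
    push Not at hcon
    apply hp i
    ext a b
    by_contra hab
    apply hcon ((p i).col b)
    · intro h
      exact hab (congrFun h a)
    · have := congrArg (fun M : Mat F => M.col b) (hi i)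
      funext c
      exact congrFun this c
  choose u hu0 hu using ex
  have huo : ∀ i j, i ≠ j → p i *ᵥ u j = 0 := by
    intro i j hij
    rw [← hu j, Matrix.mulVec_mulVec, ho i j hij, Matrix.zero_mulVec]
  have key : ∀ i, p i * (Matrix.of u)ᵀ = (Matrix.of u)ᵀ * Matrix.single i i 1 := by
    intro i
    ext a b
    have e1 : (p i * (Matrix.of u)ᵀ) a b = (p i *ᵥ u b) a := rfl
    rw [e1]
    by_cases hib : i = b
    · subst hib
      rw [hu, Matrix.mul_single_apply_same]
      simp
    · rw [huo i b hib, Matrix.mul_single_apply_of_ne _ _ _ _ _ (Ne.symm hib)]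
      rfl
  refine ⟨(Matrix.of u)ᵀ, ?_, key⟩
  intro hdet
  obtain ⟨v, hv, hv0⟩ := Matrix.exists_mulVec_eq_zero_iff.2 hdet
  apply hv
  funext i
  have : (p i * (Matrix.of u)ᵀ) *ᵥ v = 0 := by
    rw [← Matrix.mulVec_mulVec, hv0, Matrix.mulVec_zero]
  rw [key] at this
  obtain ⟨a, ha⟩ := Function.ne_iff.1 (hu0 i)
  have := congrFun this a
  simp [Matrix.mulVec, dotProduct, Matrix.mul_apply, Matrix.single_apply, ite_and] at this
  tauto

lemma orth_of_anti (h2 : (2 : F) ≠ 0) {p q : Mat F} (hp : p * p = p) 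
    (h : p * q + q * p = 0) : p * q = 0 := by
  have a1 : p * q + p * q * p = 0 := by
    have := congrArg (fun M => p * M) h
    simpa [mul_add, ← mul_assoc, hp] using this
  have a2 : p * q * p + q * p = 0 := by
    have := congrArg (fun M => M * p) h
    simpa [add_mul, mul_assoc, hp] using this
  have : (2 : F) • (p * q) = 0 := by
    rw [two_smul]
    have : p * q + p * q = (p * q + p * q * p) - (p * q * p + q * p) + (p * q + q * p) := by abel
    rw [this, a1, a2, h]
    simp
  exact (smul_eq_zero.1 this).resolve_left h2

end Freudenthal

namespace Freudenthal
variable {F : Type*} [Field F]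

lemma peirce (h2 : (2 : F) ≠ 0) {i j : Fin 3} (hij : i ≠ j) (M : Mat F)
    (hi : Matrix.single i i 1 * M + M * Matrix.single i i 1 = M)
    (hj : Matrix.single j j 1 * M + M * Matrix.single j j 1 = M) :
    M = Matrix.single i j (M i j) + Matrix.single j i (M j i) := by
  have ent : ∀ i k l : Fin 3, ((Matrix.single i i 1 : Mat F) * M + M * (Matrix.single i i 1 : Mat F) : Mat F) k l
      = (if k = i then M k l else 0) + (if l = i then M k l else 0) := by
    intro i k l
    rw [Matrix.add_apply]
    congr 1
    · split_ifs with h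
      · subst h
        simp
      · exact Matrix.single_mul_apply_of_ne _ _ _ _ _ h _
    · split_ifs with h
      · subst h
        simp
      · exact Matrix.mul_single_apply_of_ne _ _ _ _ _ h _
  have two : ∀ x : F, x + x = x → x = 0 := by
    intro x hx
    simpa using hx
  ext k l
  have e1 := ent i k l
  have e2 := ent j k l
  rw [hi] at e1
  rw [hj] at e2
  simp only [Matrix.add_apply, Matrix.single_apply]
  by_cases k1 : k = i
  · subst k1
    by_cases l1 : l = k
    · subst l1
      simp [hij, hij.symm]
      simpa using e1
    · by_cases l2 : l = j
      · subst l2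
        simp [hij, hij.symm]
      · simp [hij, hij.symm, Ne.symm l2]
        simpa [hij, l2] using e2
  · by_cases k2 : k = j
    · subst k2
      by_cases l1 : l = i
      · subst l1
        simp [hij, hij.symm]
      · simp [hij, hij.symm, Ne.symm l1]
        simpa [hij.symm, l1] using e1
    · simp [Ne.symm k1, Ne.symm k2]
      by_cases l1 : l = i
      · subst l1
        simpa [k2, hij] using e2
      · simpa [k1, l1] using e1

lemma jordan_diag (h2 : (2 : F) ≠ 0) (L : Mat F →ₗ[F] Mat F)
    (hL : ∀ X Y, L (X * Y + Y * X) = L X * L Y + L Y * L X)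
    (hE : ∀ i, L (Matrix.single i i 1) = Matrix.single i i 1) :
    ∃ a b : Fin 3 → Fin 3 → F,
      (∀ i j, i ≠ j → L (Matrix.single i j 1) = Matrix.single i j (a i j)
        + Matrix.single j i (b i j)) ∧
      (∀ i j, i ≠ j → a i j * b i j = 0) ∧
      (∀ i j, i ≠ j → a i j * a j i + b i j * b j i = 1) ∧
      (∀ i j k, i ≠ j → j ≠ k → i ≠ k → a i k = a i j * a j k ∧ b i k = b i j * b j k) := by
  have supp : ∀ i j, i ≠ j → L (Matrix.single i j 1) =
      Matrix.single i j (L (Matrix.single i j 1) i j)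
        + Matrix.single j i (L (Matrix.single i j 1) j i) := by
    intro i j hij
    apply peirce h2 hij
    · rw [← hE i, ← hL]
      simp [hij, hij.symm]
    · rw [← hE j, ← hL]
      simp [hij, hij.symm]
  refine ⟨fun i j => L (Matrix.single i j 1) i j, fun i j => L (Matrix.single i j 1) j i,
    supp, ?_, ?_, ?_⟩
  · intro i j hij
    beta_reduce
    have := hL (Matrix.single i j 1) (Matrix.single i j 1)
    rw [supp i j hij] at this
    generalize L (Matrix.single i j 1) i j = x at *
    generalize L (Matrix.single i j 1) j i = y at *
    have := congrFun (congrFun this i) i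
    simp [hij, hij.symm, add_mul, mul_add] at this
    have h3 : 2 * (x * y) = 0 := by linear_combination -this
    exact (mul_eq_zero.1 h3).resolve_left h2
  · intro i j hij
    beta_reduce
    have := hL (Matrix.single i j 1) (Matrix.single j i 1)
    rw [supp i j hij, supp j i hij.symm] at this
    generalize L (Matrix.single i j 1) i j = x at *
    generalize L (Matrix.single i j 1) j i = y at *
    generalize L (Matrix.single j i 1) i j = z at *
    generalize L (Matrix.single j i 1) j i = w at *
    have := congrFun (congrFun this i) i
    simp [hij, hij.symm, add_mul, mul_add, hE] at this
    linear_combination -this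
  · intro i j k hij hjk hik
    beta_reduce
    have := hL (Matrix.single i j 1) (Matrix.single j k 1)
    rw [supp i j hij, supp j k hjk] at this
    generalize L (Matrix.single i j 1) i j = x at *
    generalize L (Matrix.single i j 1) j i = y at *
    generalize L (Matrix.single j k 1) j k = z at *
    generalize L (Matrix.single j k 1) k j = w at *
    have t1 := congrFun (congrFun this i) k
    have t2 := congrFun (congrFun this k) i
    simp [hij, hij.symm, hjk, hjk.symm, hik, hik.symm, add_mul, mul_add] at t1 t2
    constructor
    · simpa using t1
    · rw [mul_comm]
      simpa using t2

lemma diag_case (h2 : (2 : F) ≠ 0) (L : Mat F →ₗ[F] Mat F)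
    (hL : ∀ X Y, L (X * Y + Y * X) = L X * L Y + L Y * L X)
    (hE : ∀ i, L (Matrix.single i i 1) = Matrix.single i i 1)
    (h01 : L (Matrix.single 0 1 1) 0 1 ≠ 0) :
    ∃ P Q : Mat F, ∀ X, L X = P * X * Q := by
  obtain ⟨a, b, hs, hab, hone, hm⟩ := jordan_diag h2 L hL hE
  rw [hs 0 1 (by decide)] at h01
  have a01 : a 0 1 ≠ 0 := by simpa using h01
  have b01 : b 0 1 = 0 := by simpa [a01] using hab 0 1 (by decide)
  have b02 : b 0 2 = 0 := by rw [(hm 0 1 2 (by decide) (by decide) (by decide)).2, b01, zero_mul]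
  have b21 : b 2 1 = 0 := by rw [(hm 2 0 1 (by decide) (by decide) (by decide)).2, b01, mul_zero]
  have o01 := hone 0 1 (by decide)
  have o02 := hone 0 2 (by decide)
  have o21 := hone 2 1 (by decide)
  rw [b01, zero_mul, add_zero] at o01
  rw [b02, zero_mul, add_zero] at o02
  rw [b21, zero_mul, add_zero] at o21
  have b10 : b 1 0 = 0 := by
    simpa [right_ne_zero_of_mul_eq_one o01] using hab 1 0 (by decide)
  have b20 : b 2 0 = 0 := by
    simpa [right_ne_zero_of_mul_eq_one o02] using hab 2 0 (by decide)
  have b12 : b 1 2 = 0 := by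
    simpa [right_ne_zero_of_mul_eq_one o21] using hab 1 2 (by decide)
  have m12 := (hm 1 0 2 (by decide) (by decide) (by decide)).1
  have m21 := (hm 2 0 1 (by decide) (by decide) (by decide)).1
  let d : Fin 3 → F := ![1, a 1 0, a 2 0]
  let d' : Fin 3 → F := ![1, a 0 1, a 0 2]
  have hd : ∀ i j, L (Matrix.single i j 1) = Matrix.single i j (d i * d' j) := by
    intro i j
    by_cases hij : i = j
    · subst hij
      rw [hE]
      congr 1
      fin_cases i
      · simp [d, d']
      · simp [d, d']
        rw [mul_comm, o01]
      · simp [d, d']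
        rw [mul_comm, o02]
    · rw [hs i j hij]
      fin_cases i <;> fin_cases j <;> simp_all [d, d']
  refine ⟨Matrix.diagonal d, Matrix.diagonal d', fun X => ?_⟩
  induction X using Matrix.induction_on' with
  | h_zero => simp
  | h_add p q hp hq => rw [map_add, hp, hq, mul_add, add_mul]
  | h_std_basis i j t =>
    have : Matrix.single i j t = t • Matrix.single i j (1 : F) := by simp
    rw [this, map_smul, hd]
    ext k l
    rw [Matrix.mul_diagonal, Matrix.diagonal_mul]
    simp only [Matrix.smul_apply, Matrix.single_apply, smul_eq_mul]
    split_ifs with h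
    · obtain ⟨rfl, rfl⟩ := h
      ring
    · ring

lemma jordan_final (h2 : (2 : F) ≠ 0) (L : Mat F →ₗ[F] Mat F)
    (hL : ∀ X Y, L (X * Y + Y * X) = L X * L Y + L Y * L X)
    (hE : ∀ i, L (Matrix.single i i 1) = Matrix.single i i 1) :
    ∃ P Q : Mat F, (∀ X, L X = P * X * Q) ∨ (∀ X, L X = P * Xᵀ * Q) := by
  by_cases h01 : L (Matrix.single 0 1 1) 0 1 = 0
  · let L' : Mat F →ₗ[F] Mat F := (Matrix.transposeLinearEquiv (Fin 3) (Fin 3) F F).toLinearMap ∘ₗ L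
    have eL' : ∀ X, L' X = (L X)ᵀ := fun X => rfl
    obtain ⟨P, Q, h⟩ := diag_case h2 L'
      (fun X Y => by
        rw [eL', eL', eL', hL, Matrix.transpose_add, Matrix.transpose_mul, Matrix.transpose_mul,
          add_comm])
      (fun i => by rw [eL', hE, Matrix.transpose_single])
      (by
        obtain ⟨a, b, hs, hab, hone, hm⟩ := jordan_diag h2 L hL hE
        have o := hone 0 1 (by decide)
        rw [hs 0 1 (by decide)] at h01
        have a01 : a 0 1 = 0 := by simpa using h01
        rw [a01, zero_mul, zero_add] at o
        rw [eL', hs 0 1 (by decide)]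
        simpa using left_ne_zero_of_mul_eq_one o)
    refine ⟨Qᵀ, Pᵀ, Or.inr fun X => ?_⟩
    have := congrArg Matrix.transpose (h X)
    rw [eL', Matrix.transpose_transpose] at this
    rw [this, Matrix.transpose_mul, Matrix.transpose_mul, mul_assoc]
  · obtain ⟨P, Q, h⟩ := diag_case h2 L hL hE h01
    exact ⟨P, Q, Or.inl h⟩

/-- Frobenius: classification of the determinant preservers. -/
lemma frobenius (h2 : (2 : F) ≠ 0) (h : Mat F →ₗ[F] Mat F) (hs : Function.Surjective h)
    (hd : ∀ A, (h A).det = A.det) :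
    ∃ P Q : Mat F, P.det * Q.det = 1 ∧ ((∀ X, h X = P * X * Q) ∨ (∀ X, h X = P * Xᵀ * Q)) := by
  suffices H : ∃ P Q : Mat F, (∀ X, h X = P * X * Q) ∨ (∀ X, h X = P * Xᵀ * Q) by
    obtain ⟨P, Q, H⟩ := H
    refine ⟨P, Q, ?_, H⟩
    have k := hd 1
    rcases H with H | H <;> rw [H] at k <;> simpa using k
  have dR : (h 1).det = 1 := by simp [hd]
  have uR : IsUnit (h 1).det := by simp [dR]
  set R := h 1 with hR
  let h' : Mat F →ₗ[F] Mat F := LinearMap.mulLeft F R⁻¹ ∘ₗ h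
  have eh' : ∀ X, h' X = R⁻¹ * h X := fun X => rfl
  have hs' : Function.Surjective h' := by
    intro Y
    obtain ⟨X, hX⟩ := hs (R * Y)
    exact ⟨X, by rw [eh', hX, Matrix.nonsing_inv_mul_cancel_left _ _ uR]⟩
  have hd' : ∀ A, (h' A).det = A.det := by
    intro A
    rw [eh', Matrix.det_mul, hd, Matrix.det_nonsing_inv, dR]
    simp
  have h1' : h' 1 = 1 := by
    rw [eh', ← hR, Matrix.nonsing_inv_mul _ uR]
  have hJ := jordan h2 h' hs' hd' h1'
  have hinj : Function.Injective h' := LinearMap.injective_iff_surjective.2 hs'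
  have idem : ∀ i, h' (Matrix.single i i 1) * h' (Matrix.single i i 1) = h' (Matrix.single i i 1) := by
    intro i
    have := hJ (Matrix.single i i 1) (Matrix.single i i 1)
    rw [Matrix.single_mul_single_same, mul_one, ← two_smul F, ← two_smul F, map_smul] at this
    exact (smul_right_injective _ h2 this).symm
  obtain ⟨U, hU, hUi⟩ := diag_idem (fun i => h' (Matrix.single i i 1))
    (fun i hi => by
      have := hinj (hi.trans (map_zero h').symm)
      have := congrFun (congrFun this i) i
      simp at this)
    idem
    (fun i j hij => orth_of_anti h2 (idem i) (by
      rw [← hJ]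
      simp [hij, hij.symm]))
  have uU : IsUnit U.det := isUnit_iff_ne_zero.2 hU
  let L : Mat F →ₗ[F] Mat F := LinearMap.mulLeft F U⁻¹ ∘ₗ LinearMap.mulRight F U ∘ₗ h'
  have eL : ∀ X, L X = U⁻¹ * (h' X * U) := fun X => rfl
  have LL : ∀ X Y, L X * L Y = U⁻¹ * (h' X * h' Y * U) := by
    intro X Y
    rw [eL, eL]
    calc _ = U⁻¹ * (h' X * ((U * U⁻¹) * (h' Y * U))) := by simp only [mul_assoc]
      _ = _ := by rw [Matrix.mul_nonsing_inv _ uU, one_mul, mul_assoc]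
  obtain ⟨P, Q, H⟩ := jordan_final h2 L
    (fun X Y => by rw [LL, LL, eL, hJ, add_mul, mul_add])
    (fun i => by rw [eL, hUi, Matrix.nonsing_inv_mul_cancel_left _ _ uU])
  have back : ∀ X, h X = R * (U * L X * U⁻¹) := by
    intro X
    rw [eL, Matrix.mul_nonsing_inv_cancel_left _ _ uU, Matrix.mul_nonsing_inv_cancel_right _ _ uU,
      eh', Matrix.mul_nonsing_inv_cancel_left _ _ uR]
  refine ⟨R * U * P, Q * U⁻¹, ?_⟩
  rcases H with H | H
  · left
    intro X
    rw [back, H]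
    simp only [mul_assoc]
  · right
    intro X
    rw [back, H]
    simp only [mul_assoc]

lemma final (h2 : (2 : F) ≠ 0) (g : FM F → FM F) (hg : InG F g) (he : g e0 = e0)
    (hf : g (sw e0) = sw e0) : Word F g := by
  obtain ⟨h, k, hs, hd, hk, form⟩ := levi h2 g hg he hf
  obtain ⟨P, Q, hPQ, H⟩ := frobenius h2 h hs hd
  have hP : P.det ≠ 0 := left_ne_zero_of_mul_eq_one hPQ
  have hQ : Q.det ≠ 0 := right_ne_zero_of_mul_eq_one hPQ
  let P' : GL (Fin 3) F := Matrix.GeneralLinearGroup.mkOfDetNeZero P hP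
  let Q' : GL (Fin 3) F := Matrix.GeneralLinearGroup.mkOfDetNeZero Q hQ
  have eP : (P' : Mat F) = P := rfl
  have eQ : (Q' : Mat F) = Q := rfl
  have key : ∀ a b A B, Tmap F P' Q'⁻¹ (a, b, A, B)
      = (a, b, P * A * Q, ((Q'⁻¹ : GL (Fin 3) F) : Mat F) * B * ((P'⁻¹ : GL (Fin 3) F) : Mat F)) := by
    intro a b A B
    apply FM_ext
    · simp only [Tmap, GL_det_inv, eP, eQ]
      rw [div_eq_mul_inv, ← mul_inv, mul_comm Q.det, hPQ, inv_one, one_mul]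
    · simp only [Tmap, GL_det_inv, eP, eQ]
      rw [div_inv_eq_mul, hPQ, one_mul]
    · simp only [Tmap, inv_inv, eP, eQ]
    · rfl
  have tbk : ∀ A B, tb F (P * A * Q)
      (((Q'⁻¹ : GL (Fin 3) F) : Mat F) * B * ((P'⁻¹ : GL (Fin 3) F) : Mat F)) = tb F A B := by
    intro A B
    exact tb_conj' _ _ _ _ _ _ (Units.mul_inv Q') (Units.inv_mul P')
  have kdet : ∀ B Y, (∀ A, tb F (h A) Y = tb F A B) → k B = Y := by
    intro B Y hY
    rw [← sub_eq_zero]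
    apply nondeg'
    intro Z
    obtain ⟨A, rfl⟩ := hs Z
    have : tb F (h A) (k B - Y) = tb F (h A) (k B) - tb F (h A) Y := by
      simp [tb, mul_sub]
    rw [this, hk, hY, sub_self]
  rcases H with H | H
  · have : g = Tmap F P' Q'⁻¹ := by
      funext ⟨a, b, A, B⟩
      rw [form, key, H]
      rw [kdet B _ (fun A => by rw [H]; exact tbk A B)]
    rw [this]
    exact .tmap _ _
  · have : g = Tmap F P' Q'⁻¹ ∘ Ttr F := by
      funext ⟨a, b, A, B⟩
      change _ = Tmap F P' Q'⁻¹ (a, b, Aᵀ, Bᵀ)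
      rw [form, key, H]
      rw [kdet B _ (fun A => by rw [H]; exact (tbk Aᵀ Bᵀ).trans (tb_tr A B))]
    rw [this]
    exact .comp (.tmap _ _) .ttr

end Freudenthal


/-- **Generators of `G(M)` over a field** (char `≠ 2, 3`): every element of `G(M)` is a
finite product of the elementary transformations `φ(C)`, `ψ(D)`, `T(P,Q)`, `T(t)`. -/
theorem generators_of_G_field (F : Type*) [Field F] (h2 : (2 : F) ≠ 0) (h3 : (3 : F) ≠ 0)
    (g : FM F → FM F) (hg : InG F g) : Word F g := by
  exact reduce h2 h3 (final h2) g hg
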